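/- arXiv:2406.07273 — 2 statements merged into one kernel-verified Lean document; each statement's English description precedes it below -/
import Mathlib

section
/- There exists a real Banach space X, linearly homeomorphic to c₀, such that no closed linear subspace M of X with dim(X/M) = 2 is proximinal; that is, for every such M there exists x ∈ X such that no m ∈ M satisfies ‖x − m‖ = dist(x, M). -/
open Filter Topology ZeroAtInfty

theorem eventually_zero_of_tsum {a : ℕ → ℝ} {C : ℝ} (ha : ∀ n, |a n| ≤ C)
    (h : ∀ᶠ k in (atTop : Filter ℕ), ∑' n, a n * (1 / 2 : ℝ) ^ ((n + 1) * (k + 1)) = 0) (n : ℕ) :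
    a n = 0 := by
  have hhalf : ∀ m : ℕ, (0 : ℝ) < (1 / 2) ^ m := fun m => by positivity
  have hC : 0 ≤ C := (abs_nonneg _).trans (ha 0)
  induction n using Nat.strong_induction_on with
  | _ n ih =>
  have hgeo : HasSum (fun m : ℕ => (1 / 2 : ℝ) ^ m) 2 := hasSum_geometric_two
  have hbound : ∀ᶠ k in (atTop : Filter ℕ), |a n| ≤ 2 * C * (1 / 2 : ℝ) ^ k := by
    filter_upwards [h] with k hk
    have hterm : ∀ m, |a m * (1 / 2 : ℝ) ^ ((m + 1) * (k + 1))| ≤ C * (1 / 2) ^ m := fun m => by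
      rw [abs_mul, abs_of_pos (hhalf _)]
      refine mul_le_mul (ha m) (pow_le_pow_of_le_one (by norm_num) (by norm_num) ?_)
        (hhalf _).le hC
      nlinarith
    have hsum : Summable fun m => a m * (1 / 2 : ℝ) ^ ((m + 1) * (k + 1)) :=
      Summable.of_norm_bounded (hgeo.summable.mul_left C) hterm
    rw [← hsum.sum_add_tsum_nat_add (n + 1), Finset.sum_range_succ,
      Finset.sum_eq_zero fun m hm => by rw [ih m (Finset.mem_range.1 hm), zero_mul]] at hk
    have htail : ‖∑' m, a (m + (n + 1)) * (1 / 2 : ℝ) ^ ((m + (n + 1) + 1) * (k + 1))‖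
        ≤ C * (1 / 2) ^ ((n + 1) * (k + 1) + k) * 2 := by
      refine tsum_of_norm_bounded (hgeo.mul_left _) fun m => ?_
      rw [Real.norm_eq_abs, abs_mul, abs_of_pos (hhalf _), mul_assoc, ← pow_add]
      refine mul_le_mul (ha _) (pow_le_pow_of_le_one (by norm_num) (by norm_num) ?_)
        (hhalf _).le hC
      nlinarith
    have heq : |a n| * (1 / 2 : ℝ) ^ ((n + 1) * (k + 1))
        ≤ (2 * C * (1 / 2) ^ k) * (1 / 2) ^ ((n + 1) * (k + 1)) := by
      rw [← abs_of_pos (hhalf ((n + 1) * (k + 1))), ← abs_mul, abs_of_pos (hhalf _)]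
      rw [zero_add] at hk
      rw [eq_neg_of_add_eq_zero_left hk, abs_neg]
      refine htail.trans (le_of_eq ?_)
      rw [pow_add]; ring
    exact le_of_mul_le_mul_right heq (hhalf _)
  have hlim : Tendsto (fun k : ℕ => 2 * C * (1 / 2 : ℝ) ^ k) atTop (𝓝 (2 * C * 0)) :=
    (tendsto_pow_atTop_nhds_zero_of_lt_one (by norm_num) (by norm_num)).const_mul _
  have := ge_of_tendsto hlim hbound
  rw [mul_zero] at this
  exact abs_nonpos_iff.1 this

theorem le_of_forall_small {a b K : ℝ} (δ : ℝ) (hδ : 0 < δ)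
    (h : ∀ t, 0 < t → t ≤ δ → t * a ≤ t * b + t ^ 2 * K) : a ≤ b := by
  have hlim : Tendsto (fun t : ℝ => b + t * K) (𝓝[>] 0) (𝓝 (b + 0 * K)) :=
    ((continuous_const.add (continuous_id.mul continuous_const)).tendsto 0).mono_left
      nhdsWithin_le_nhds
  rw [zero_mul, add_zero] at hlim
  refine ge_of_tendsto hlim ?_
  filter_upwards [Ioc_mem_nhdsGT hδ] with t ht
  refine le_of_mul_le_mul_left ?_ ht.1
  linarith [h t ht.1 ht.2, show t * (b + t * K) = t * b + t ^ 2 * K by ring]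

theorem norm_add_le_of_ne_zero {H : Type*} [NormedAddCommGroup H] [InnerProductSpace ℝ H]
    {u : H} (hu : u ≠ 0) (v : H) :
    ‖u + v‖ ≤ ‖u‖ + inner ℝ u v / ‖u‖ + ‖v‖ ^ 2 / (2 * ‖u‖) := by
  have hu' : 0 < ‖u‖ := norm_pos_iff.2 hu
  have h1 := norm_add_sq_real u v
  have h2 : ‖u‖ + inner ℝ u v / ‖u‖ + ‖v‖ ^ 2 / (2 * ‖u‖)
      = (2 * ‖u‖ ^ 2 + 2 * inner ℝ u v + ‖v‖ ^ 2) / (2 * ‖u‖) := by field_simp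
  rw [h2, le_div_iff₀ (by positivity)]
  nlinarith [sq_nonneg (‖u + v‖ - ‖u‖)]

theorem not_forall_norm_eq_sum_abs {H ι : Type*} [NormedAddCommGroup H] [InnerProductSpace ℝ H]
    (u v : H) (G : Finset ι) (a b : ι → ℝ)
    (hind : ∀ s t : ℝ, s • u + t • v = 0 → s = 0 ∧ t = 0) :
    ¬ ∀ s t : ℝ, ‖s • u + t • v‖ = ∑ n ∈ G, |s * a n + t * b n| := by
  classical
  intro h
  obtain ⟨n, hn, han⟩ : ∃ n ∈ G, a n ≠ 0 := by
    by_contra! hcon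
    have h0 := h 1 0
    rw [Finset.sum_eq_zero fun n hn => by simp [hcon n hn]] at h0
    simpa using (hind 1 0 (norm_eq_zero.1 h0)).1
  set p : H := b n • u + (-a n) • v with hp
  have hp0 : 0 < ‖p‖ := norm_pos_iff.2 fun hz => han (neg_eq_zero.1 (hind _ _ hz).2)
  have hgap : ∀ ε : ℝ, 0 < ε → 2 * ‖p‖ + 2 * ε * |a n| ≤ ‖p + ε • u‖ + ‖p - ε • u‖ := by
    intro ε hε
    have e1 : p + ε • u = (b n + ε) • u + (-a n) • v := by rw [hp]; module
    have e2 : p - ε • u = (b n - ε) • u + (-a n) • v := by rw [hp]; module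
    rw [e1, e2, hp, h, h, h, ← Finset.sum_add_distrib, ← Finset.add_sum_erase _ _ hn,
      ← Finset.add_sum_erase _ _ hn, mul_add, Finset.mul_sum]
    have hrest : ∑ i ∈ G.erase n, 2 * |b n * a i + -a n * b i| ≤
        ∑ i ∈ G.erase n, (|(b n + ε) * a i + -a n * b i| + |(b n - ε) * a i + -a n * b i|) := by
      refine Finset.sum_le_sum fun i _ => ?_
      have := abs_add_le ((b n + ε) * a i + -a n * b i) ((b n - ε) * a i + -a n * b i)
      rwa [show (b n + ε) * a i + -a n * b i + ((b n - ε) * a i + -a n * b i)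
        = 2 * (b n * a i + -a n * b i) by ring, abs_mul, abs_two] at this
    have hmain : |b n * a n + -a n * b n| = 0 := by rw [abs_eq_zero]; ring
    have hplus : |(b n + ε) * a n + -a n * b n| = ε * |a n| := by
      rw [show (b n + ε) * a n + -a n * b n = ε * a n by ring, abs_mul, abs_of_pos hε]
    have hminus : |(b n - ε) * a n + -a n * b n| = ε * |a n| := by
      rw [show (b n - ε) * a n + -a n * b n = -(ε * a n) by ring, abs_neg, abs_mul, abs_of_pos hε]
    rw [hmain, hplus, hminus]
    linarith
  have hle : 2 * ‖p‖ * |a n| ≤ 0 := by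
    refine le_of_forall_small (K := ‖u‖ ^ 2) 1 one_pos fun ε hε _ => ?_
    have hpar := parallelogram_law_with_norm ℝ p (ε • u)
    rw [norm_smul, Real.norm_eq_abs, abs_of_pos hε] at hpar
    have hg := hgap ε hε
    have hsq : (2 * ‖p‖ + 2 * ε * |a n|) ^ 2 ≤ (‖p + ε • u‖ + ‖p - ε • u‖) ^ 2 := by
      gcongr
    nlinarith [sq_nonneg (‖p + ε • u‖ - ‖p - ε • u‖), sq_nonneg (ε * |a n|)]
  have : 0 < 2 * ‖p‖ * |a n| := by have := abs_pos.2 han; positivity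
  linarith

namespace ZeroAtInftyContinuousMap

theorem norm_apply_le (x : C₀(ℕ, ℝ)) (n : ℕ) : |x n| ≤ ‖x‖ := x.toBCF.norm_coe_le_norm n

theorem norm_le_of_forall {x : C₀(ℕ, ℝ)} {C : ℝ} (hC : 0 ≤ C) (h : ∀ n, |x n| ≤ C) : ‖x‖ ≤ C :=
  (BoundedContinuousFunction.norm_le (f := x.toBCF) hC).2 h

/-- The function equal to `a` on the finite set `F` and to zero elsewhere. -/
def ofFinset (F : Finset ℕ) (a : ℕ → ℝ) : C₀(ℕ, ℝ) where
  toFun n := if n ∈ F then a n else 0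
  continuous_toFun := continuous_of_discreteTopology
  zero_at_infty' := by
    rw [cocompact_eq_cofinite]
    refine tendsto_const_nhds.congr' ?_
    filter_upwards [F.finite_toSet.compl_mem_cofinite] with n hn
    exact (if_neg hn).symm

theorem ofFinset_apply (F : Finset ℕ) (a : ℕ → ℝ) (n : ℕ) :
    ofFinset F a n = if n ∈ F then a n else 0 := rfl

/-- The canonical unit vectors of `c₀`. -/
def unitVec (n : ℕ) : C₀(ℕ, ℝ) := ofFinset {n} 1

theorem unitVec_apply (n m : ℕ) : unitVec n m = if m = n then 1 else 0 := by
  simp [unitVec, ofFinset_apply]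

/-- Evaluation at `n` as a continuous linear functional. -/
noncomputable def evalL (n : ℕ) : C₀(ℕ, ℝ) →L[ℝ] ℝ :=
  LinearMap.mkContinuous (IsLinearMap.mk' (fun x : C₀(ℕ, ℝ) => x n) ⟨fun _ _ => rfl, fun _ _ => rfl⟩)
    1 fun x => by simpa using norm_apply_le x n

theorem evalL_apply (n : ℕ) (x : C₀(ℕ, ℝ)) : evalL n x = x n := rfl

theorem norm_evalL_le (n : ℕ) : ‖evalL n‖ ≤ 1 := LinearMap.mkContinuous_norm_le _ zero_le_one _

theorem ofFinset_eq_sum (F : Finset ℕ) (a : ℕ → ℝ) :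
    ofFinset F a = ∑ n ∈ F, a n • unitVec n := by
  ext m
  rw [← evalL_apply m (∑ n ∈ F, a n • unitVec n), map_sum, ofFinset_apply]
  simp [evalL_apply, unitVec_apply]

theorem finite_setOf_le_abs (x : C₀(ℕ, ℝ)) {ε : ℝ} (hε : 0 < ε) : {n | ε ≤ |x n|}.Finite := by
  have h := x.zero_at_infty'
  rw [cocompact_eq_cofinite] at h
  have h2 := h.abs.eventually (gt_mem_nhds (show |(0 : ℝ)| < ε by simpa using hε))
  refine (eventually_cofinite.1 h2).subset fun n hn => not_lt.2 hn

end ZeroAtInftyContinuousMap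

open ZeroAtInftyContinuousMap

/-- A functional attaining its norm for `‖x‖ + ‖R x‖` is the sum of a functional in `c₀⋆` with
finite support and of a functional factoring through `R`, both of the same norm. -/
theorem exists_decomposition_of_attains {H : Type*} [NormedAddCommGroup H] [InnerProductSpace ℝ H]
    (R : C₀(ℕ, ℝ) →L[ℝ] H) (h : C₀(ℕ, ℝ) →L[ℝ] ℝ) {c : ℝ} {x : C₀(ℕ, ℝ)} (hx : x ≠ 0)
    (hRx : R x ≠ 0) (hc : 0 ≤ c) (hle : ∀ y, h y ≤ c * (‖y‖ + ‖R y‖))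
    (hattain : h x = c * (‖x‖ + ‖R x‖)) :
    ∃ (γ : H) (F : Finset ℕ), ‖γ‖ = c ∧ (∀ n ∉ F, h (unitVec n) = inner ℝ γ (R (unitVec n))) ∧
      ∑ n ∈ F, |h (unitVec n) - inner ℝ γ (R (unitVec n))| = c := by
  have hx' : 0 < ‖x‖ := norm_pos_iff.2 hx
  have hRx' : 0 < ‖R x‖ := norm_pos_iff.2 hRx
  set γ : H := (c / ‖R x‖) • R x with hγ
  set w : C₀(ℕ, ℝ) →L[ℝ] ℝ := h - (innerSL ℝ γ).comp R with hw
  have hw_apply : ∀ y, w y = h y - inner ℝ γ (R y) := fun y => rfl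
  have hγ_inner : ∀ v, inner ℝ γ v = c * (inner ℝ (R x) v / ‖R x‖) := fun v => by
    rw [hγ, real_inner_smul_left]; ring
  have hwx : w x = c * ‖x‖ := by
    rw [hw_apply, hattain, hγ_inner, real_inner_self_eq_norm_sq]; field_simp; ring
  have hkey : ∀ y (t : ℝ), t * w y ≤ c * (‖x + t • y‖ - ‖x‖)
      + t ^ 2 * (c * (‖R y‖ ^ 2 / (2 * ‖R x‖))) := by
    intro y t
    have h1 := hle (x + t • y)
    have h2 := mul_le_mul_of_nonneg_left (norm_add_le_of_ne_zero hRx (t • R y)) hc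
    rw [map_add, map_smul, hattain, map_add, map_smul, smul_eq_mul] at h1
    rw [real_inner_smul_right, norm_smul, mul_pow, Real.norm_eq_abs, sq_abs] at h2
    rw [hw_apply, hγ_inner]
    have e : c * (‖R x‖ + t * inner ℝ (R x) (R y) / ‖R x‖ + t ^ 2 * ‖R y‖ ^ 2 / (2 * ‖R x‖))
      = c * ‖R x‖ + t * (c * (inner ℝ (R x) (R y) / ‖R x‖))
        + t ^ 2 * (c * (‖R y‖ ^ 2 / (2 * ‖R x‖))) := by ring
    rw [e] at h2
    linarith
  have hw_le : ∀ y, w y ≤ c * ‖y‖ := fun y => by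
    refine le_of_forall_small (K := c * (‖R y‖ ^ 2 / (2 * ‖R x‖))) 1 one_pos
      fun t ht _ => (hkey y t).trans ?_
    have h3 : ‖x + t • y‖ - ‖x‖ ≤ t * ‖y‖ := by
      have := norm_add_le x (t • y)
      rw [norm_smul, Real.norm_eq_abs, abs_of_pos ht] at this
      linarith
    have := mul_le_mul_of_nonneg_left h3 hc
    linarith
  set F : Finset ℕ := (finite_setOf_le_abs x (half_pos hx')).toFinset with hF
  have hw_nonpos : ∀ y : C₀(ℕ, ℝ), (∀ n ∈ F, y n = 0) → w y ≤ 0 := by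
    intro y hy
    have hd : 0 < ‖x‖ / 2 / (‖y‖ + 1) := by positivity
    refine le_of_forall_small (K := c * (‖R y‖ ^ 2 / (2 * ‖R x‖))) _ hd
      fun t ht htd => (hkey y t).trans ?_
    rw [le_div_iff₀ (by positivity)] at htd
    have h4 : ‖x + t • y‖ ≤ ‖x‖ := by
      refine norm_le_of_forall hx'.le fun n => ?_
      rw [ZeroAtInftyContinuousMap.add_apply, ZeroAtInftyContinuousMap.smul_apply, smul_eq_mul]
      by_cases hn : n ∈ F
      · rw [hy n hn, mul_zero, add_zero]
        exact norm_apply_le x n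
      · have h5 : |x n| < ‖x‖ / 2 := by simpa [hF] using hn
        have h6 : |t * y n| ≤ ‖x‖ / 2 := by
          rw [abs_mul, abs_of_pos ht]
          have := mul_le_mul_of_nonneg_left (norm_apply_le y n) ht.le
          linarith
        have := abs_add_le (x n) (t * y n)
        linarith
    have := mul_nonpos_of_nonneg_of_nonpos hc (sub_nonpos.2 h4)
    linarith
  have hw_zero : ∀ y : C₀(ℕ, ℝ), (∀ n ∈ F, y n = 0) → w y = 0 := fun y hy => by
    refine le_antisymm (hw_nonpos y hy) ?_
    have := hw_nonpos (-y) fun n hn => by rw [ZeroAtInftyContinuousMap.neg_apply, hy n hn, neg_zero]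
    rw [map_neg] at this
    linarith
  refine ⟨γ, F, ?_, fun n hn => ?_, ?_⟩
  · rw [hγ, norm_smul, Real.norm_eq_abs, abs_of_nonneg (by positivity)]
    field_simp
  · refine sub_eq_zero.1 ((hw_apply _).symm.trans (hw_zero _ fun m hm => ?_))
    rw [unitVec_apply, if_neg (by rintro rfl; exact hn hm)]
  · simp_rw [← hw_apply]
    apply le_antisymm
    · have hy1 : ‖ofFinset F fun n => SignType.sign (w (unitVec n))‖ ≤ 1 := by
        refine norm_le_of_forall zero_le_one fun n => ?_
        rw [ofFinset_apply]
        split_ifs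
        · rcases lt_trichotomy (w (unitVec n)) 0 with h0 | h0 | h0 <;> simp [h0]
        · simp
      have := hw_le (ofFinset F fun n => SignType.sign (w (unitVec n)))
      rw [ofFinset_eq_sum, map_sum] at this
      simp_rw [map_smul, smul_eq_mul, sign_mul_self] at this
      rw [← ofFinset_eq_sum] at this
      exact this.trans (mul_le_of_le_one_right hc hy1)
    · have h7 : w (x - ofFinset F x) = 0 := hw_zero _ fun n hn => by
        rw [ZeroAtInftyContinuousMap.sub_apply, ofFinset_apply, if_pos hn, sub_self]
      rw [map_sub, sub_eq_zero, hwx, ofFinset_eq_sum, map_sum] at h7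
      refine le_of_mul_le_mul_right ?_ hx'
      rw [h7, Finset.sum_mul]
      refine Finset.sum_le_sum fun n _ => ?_
      rw [map_smul, smul_eq_mul, mul_comm]
      refine (le_abs_self _).trans ?_
      rw [abs_mul]
      exact mul_le_mul_of_nonneg_left (norm_apply_le x n) (abs_nonneg _)

theorem exists_operator_hasSum_inner {E H : Type*} [NormedAddCommGroup E] [NormedSpace ℝ E]
    [NormedAddCommGroup H] [InnerProductSpace ℝ H] [CompleteSpace H] (f : ℕ → E →L[ℝ] ℝ)
    (hf : ∀ n, ‖f n‖ ≤ 1) (b : ℕ → H) (hb : ∀ k, ‖b k‖ ≤ 1) :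
    ∃ R : E →L[ℝ] H, ∀ γ x, HasSum (fun p : ℕ × ℕ =>
      (1 / 2 : ℝ) ^ ((p.1 + 1) * (p.2 + 1)) * (f p.1 x * inner ℝ (b p.2) γ)) (inner ℝ γ (R x)) := by
  set T : ℕ × ℕ → E →L[ℝ] H := fun p =>
    (1 / 2 : ℝ) ^ ((p.1 + 1) * (p.2 + 1)) • (f p.1).smulRight (b p.2) with hT
  have hgeo : Summable fun m : ℕ => (1 / 2 : ℝ) ^ m := summable_geometric_two
  have hgeo' : Summable fun p : ℕ × ℕ => (1 / 2 : ℝ) ^ p.1 * (1 / 2 : ℝ) ^ p.2 :=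
    hgeo.mul_of_nonneg hgeo (fun m => by positivity) fun m => by positivity
  have hTsum : Summable T := by
    refine Summable.of_norm_bounded hgeo' fun p => ?_
    rw [hT, norm_smul, ContinuousLinearMap.norm_smulRight_apply, Real.norm_eq_abs,
      abs_of_pos (by positivity), ← pow_add]
    refine (mul_le_of_le_one_right (by positivity)
      (mul_le_one₀ (hf _) (norm_nonneg _) (hb _))).trans ?_
    exact pow_le_pow_of_le_one (by norm_num) (by norm_num) (by nlinarith)
  refine ⟨∑' p, T p, fun γ x => ?_⟩
  have h1 := ((innerSL ℝ γ).comp (ContinuousLinearMap.apply ℝ H x)).hasSum hTsum.hasSum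
  convert! h1 using 2 with p
  simp [hT, real_inner_comm]

/-- An injective operator from `c₀` to `ℓ²` whose adjoint has no nonzero finitely supported
sequence in its range. -/
theorem exists_injective_operator :
    ∃ R : C₀(ℕ, ℝ) →L[ℝ] lp (fun _ : ℕ => ℝ) 2, (∀ x, R x = 0 → x = 0) ∧
      ∀ (γ : lp (fun _ : ℕ => ℝ) 2) (F : Finset ℕ),
        (∀ n ∉ F, inner ℝ γ (R (unitVec n)) = 0) → γ = 0 := by
  set b : ℕ → lp (fun _ : ℕ => ℝ) 2 := fun k => lp.single 2 k 1 with hb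
  have hb_norm : ∀ k, ‖b k‖ = 1 := fun k => by
    rw [hb, lp.norm_single (by norm_num), norm_one]
  have hb_inner : ∀ k (γ : lp (fun _ : ℕ => ℝ) 2), inner ℝ (b k) γ = γ k := fun k γ => by
    rw [hb, lp.inner_single_left]; simp
  obtain ⟨R, hR⟩ := exists_operator_hasSum_inner evalL norm_evalL_le b fun k => (hb_norm k).le
  refine ⟨R, fun x hx => ?_, fun γ F hγ => ?_⟩
  · ext n
    refine eventually_zero_of_tsum (C := ‖x‖) (norm_apply_le x) (Eventually.of_forall fun k => ?_) n
    have h1 := hR (b k) x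
    rw [hx, inner_zero_right, ← Function.Injective.hasSum_iff (Prod.mk_left_injective k)] at h1
    · refine (h1.congr_fun fun n => ?_).tsum_eq
      have hn : b k k = 1 := by simp [hb]
      simp [evalL_apply, hb_inner, hn, mul_comm]
    · rintro ⟨n, j⟩ hnj
      have hj : j ≠ k := fun hj => hnj ⟨n, by rw [hj]⟩
      have hn : b k j = 0 := by simp [hb, hj]
      simp [evalL_apply, hb_inner, hn]
  · ext k
    refine eventually_zero_of_tsum (C := ‖γ‖) (lp.norm_apply_le_norm (by norm_num) γ) ?_ k
    obtain ⟨N, hN⟩ := F.bddAbove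
    filter_upwards [eventually_gt_atTop N] with n hn
    have h1 := hR γ (unitVec n)
    rw [hγ n fun h => (hN h).not_gt hn,
      ← Function.Injective.hasSum_iff (Prod.mk_right_injective n)] at h1
    · refine (h1.congr_fun fun j => ?_).tsum_eq
      simp [evalL_apply, hb_inner, unitVec_apply, mul_comm]
    · rintro ⟨m, j⟩ hmj
      have hm : m ≠ n := fun hm => hmj ⟨j, by rw [hm]⟩
      simp [evalL_apply, unitVec_apply, hm]


/-- A functional vanishing on a proximinal subspace of finite codimension attains its norm. -/
theorem exists_attains_of_proximinal {X : Type*} [NormedAddCommGroup X] [NormedSpace ℝ X]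
    (M : Submodule ℝ X) (hM : IsClosed (M : Set X)) [FiniteDimensional ℝ (X ⧸ M)]
    (hprox : ∀ x : X, ∃ m ∈ M, ‖x - m‖ = Metric.infDist x (M : Set X))
    (φ : X ⧸ M →ₗ[ℝ] ℝ) (hφ : φ ≠ 0) :
    ∃ c : ℝ, 0 ≤ c ∧ (∀ y, φ (M.mkQ y) ≤ c * ‖y‖) ∧ ∃ x ≠ 0, φ (M.mkQ x) = c * ‖x‖ := by
  let : NormedAddCommGroup (X ⧸ M) := Submodule.Quotient.normedAddCommGroup M
  have : ProperSpace (X ⧸ M) := FiniteDimensional.proper ℝ _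
  have hcont : Continuous φ := φ.continuous_of_finiteDimensional
  obtain ⟨z, hz, hmax⟩ := (isCompact_closedBall (0 : X ⧸ M) 1).exists_isMaxOn
    ⟨0, Metric.mem_closedBall_self zero_le_one⟩ hcont.continuousOn
  have hle : ∀ v, φ v ≤ φ z * ‖v‖ := fun v => by
    rcases eq_or_ne v 0 with rfl | hv
    · simp
    have hv' : 0 < ‖v‖ := norm_pos_iff.2 hv
    have h1 : φ (‖v‖⁻¹ • v) ≤ φ z := hmax (by simp [norm_smul, hv'.ne'])
    rw [map_smul, smul_eq_mul, inv_mul_le_iff₀ hv'] at h1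
    linarith
  have hz1 : ‖z‖ ≤ 1 := by simpa using hz
  have hc : 0 ≤ φ z := by simpa using hmax (Metric.mem_closedBall_self zero_le_one)
  have hc' : 0 < φ z := by
    refine hc.lt_of_ne fun h0 => hφ (LinearMap.ext fun v => le_antisymm ?_ ?_)
    · simpa [← h0] using hle v
    · simpa [← h0] using hle (-v)
  obtain ⟨x, rfl⟩ := M.mkQ_surjective z
  obtain ⟨m, hm, hxm⟩ := hprox x
  have hmk : M.mkQ (x - m) = M.mkQ x := by
    rw [map_sub, sub_eq_self]; simpa using hm
  have hnorm : ‖x - m‖ = ‖M.mkQ x‖ :=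
    hxm.trans (QuotientAddGroup.norm_mk (S := M.toAddSubgroup) x).symm
  refine ⟨_, hc, fun y => (hle _).trans ?_, x - m, fun h0 => ?_, ?_⟩
  · exact mul_le_mul_of_nonneg_left (Submodule.Quotient.norm_mk_le M y) hc
  · rw [← hmk, h0, map_zero, map_zero] at hc'
    exact hc'.false
  · rw [hmk]
    refine le_antisymm ?_ ?_
    · rw [hnorm]; exact hle _
    · rw [hnorm]; exact mul_le_of_le_one_right hc hz1

theorem not_proximinal_of_norm_eq {X H : Type*} [NormedAddCommGroup X] [NormedSpace ℝ X]
    [NormedAddCommGroup H] [InnerProductSpace ℝ H] (R : C₀(ℕ, ℝ) →L[ℝ] H)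
    (hR : ∀ x, R x = 0 → x = 0)
    (hRadj : ∀ (γ : H) (F : Finset ℕ), (∀ n ∉ F, inner ℝ γ (R (unitVec n)) = 0) → γ = 0)
    (e : X ≃L[ℝ] C₀(ℕ, ℝ)) (he : ∀ x, ‖x‖ = ‖e x‖ + ‖R (e x)‖)
    (M : Submodule ℝ X) (hM : IsClosed (M : Set X)) (hdim : Module.finrank ℝ (X ⧸ M) = 2) :
    ∃ x : X, ∀ m ∈ M, ‖x - m‖ ≠ Metric.infDist x (M : Set X) := by
  by_contra! hprox
  have : FiniteDimensional ℝ (X ⧸ M) := Module.finite_of_finrank_pos (by omega)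
  have : IsClosed (M : Set X) := hM
  let : NormedAddCommGroup (X ⧸ M) := Submodule.Quotient.normedAddCommGroup M
  set B := Module.finBasisOfFinrankEq ℝ (X ⧸ M) hdim
  obtain ⟨L, hL⟩ : ∃ L : (X ⧸ M →ₗ[ℝ] ℝ) →ₗ[ℝ] C₀(ℕ, ℝ) →ₗ[ℝ] ℝ,
      ∀ φ y, L φ y = φ (M.mkQ (e.symm y)) :=
    ⟨LinearMap.lcomp ℝ ℝ (M.mkQ ∘ₗ (e.symm : C₀(ℕ, ℝ) →ₗ[ℝ] X)), fun _ _ => rfl⟩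
  have hdecomp : ∀ φ : X ⧸ M →ₗ[ℝ] ℝ, ∃ (γ : H) (F : Finset ℕ), (γ = 0 → φ = 0) ∧
      (∀ n ∉ F, L φ (unitVec n) = inner ℝ γ (R (unitVec n))) ∧
      ∑ n ∈ F, |L φ (unitVec n) - inner ℝ γ (R (unitVec n))| = ‖γ‖ := by
    intro φ
    by_cases hφ : φ = 0
    · exact ⟨0, ∅, fun _ => hφ, by simp [hφ], by simp⟩
    obtain ⟨c, hc, hle, x, hx, hxc⟩ := exists_attains_of_proximinal M hM hprox φ hφ
    have hcont : Continuous (L φ) := by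
      have h1 : Continuous fun y => φ (M.mkQ (e.symm y)) :=
        φ.continuous_of_finiteDimensional.comp (M.mkQL.continuous.comp e.symm.continuous)
      exact h1.congr fun y => (hL φ y).symm
    have hex : e x ≠ 0 := fun h0 => hx (e.map_eq_zero_iff.1 h0)
    obtain ⟨γ, F, hγ, h1, h2⟩ := exists_decomposition_of_attains R ⟨L φ, hcont⟩ (c := c) hex
      (fun h0 => hex (hR _ h0)) hc
      (fun y => by simpa [hL, he] using hle (e.symm y)) (by simpa [hL, he] using hxc)
    refine ⟨γ, F, fun h0 => ?_, h1, h2.trans hγ.symm⟩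
    rw [← hγ, h0, norm_zero] at hle
    refine LinearMap.ext fun v => ?_
    obtain ⟨y, rfl⟩ := M.mkQ_surjective v
    refine le_antisymm (by simpa using hle y) ?_
    have := hle (-y)
    rw [map_neg, map_neg] at this
    simpa using this
  obtain ⟨γ₀, F₀, -, hF₀, -⟩ := hdecomp (B.coord 0)
  obtain ⟨γ₁, F₁, -, hF₁, -⟩ := hdecomp (B.coord 1)
  have huniq : ∀ s t : ℝ, (s • γ₀ + t • γ₁ = 0 → s • B.coord 0 + t • B.coord 1 = 0) ∧
      ‖s • γ₀ + t • γ₁‖ = ∑ n ∈ F₀ ∪ F₁,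
        |s * (L (B.coord 0) (unitVec n) - inner ℝ γ₀ (R (unitVec n)))
          + t * (L (B.coord 1) (unitVec n) - inner ℝ γ₁ (R (unitVec n)))| := by
    intro s t
    obtain ⟨γ, F, hγ, hF, hsum⟩ := hdecomp (s • B.coord 0 + t • B.coord 1)
    have hLst : ∀ n, L (s • B.coord 0 + t • B.coord 1) (unitVec n)
        = s * L (B.coord 0) (unitVec n) + t * L (B.coord 1) (unitVec n) := fun n => by
      simp only [map_add, map_smul, LinearMap.add_apply, LinearMap.smul_apply, smul_eq_mul]
    have hγst : γ = s • γ₀ + t • γ₁ := by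
      refine sub_eq_zero.1 (hRadj _ (F ∪ (F₀ ∪ F₁)) fun n hn => ?_)
      simp only [Finset.mem_union, not_or] at hn
      rw [inner_sub_left, inner_add_left, real_inner_smul_left, real_inner_smul_left,
        ← hF n hn.1, ← hF₀ n hn.2.1, ← hF₁ n hn.2.2, hLst, sub_self]
    have hterm : ∀ n, L (s • B.coord 0 + t • B.coord 1) (unitVec n) - inner ℝ γ (R (unitVec n))
        = s * (L (B.coord 0) (unitVec n) - inner ℝ γ₀ (R (unitVec n)))
          + t * (L (B.coord 1) (unitVec n) - inner ℝ γ₁ (R (unitVec n))) := fun n => by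
      rw [hLst, hγst, inner_add_left, real_inner_smul_left, real_inner_smul_left]; ring
    refine ⟨fun h0 => hγ (hγst.trans h0), ?_⟩
    rw [← hγst, ← hsum]
    simp_rw [← hterm]
    rw [Finset.sum_subset (Finset.subset_union_left : F ⊆ F ∪ (F₀ ∪ F₁)) fun n _ hn => by
        rw [hF n hn, sub_self, abs_zero],
      Finset.sum_subset (Finset.subset_union_right : F₀ ∪ F₁ ⊆ F ∪ (F₀ ∪ F₁)) fun n _ hn => ?_]
    simp only [Finset.mem_union, not_or] at hn
    rw [hterm, hF₀ n hn.1, hF₁ n hn.2]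
    simp
  refine not_forall_norm_eq_sum_abs γ₀ γ₁ (F₀ ∪ F₁) _ _ (fun s t h0 => ?_) fun s t => (huniq s t).2
  have hB := (huniq s t).1 h0
  constructor
  · simpa using LinearMap.congr_fun hB (B 0)
  · simpa using LinearMap.congr_fun hB (B 1)

theorem exists_equiv_norm_eq {E H : Type} [NormedAddCommGroup E] [NormedSpace ℝ E]
    [CompleteSpace E] [NormedAddCommGroup H] [NormedSpace ℝ H] [CompleteSpace H] (R : E →L[ℝ] H) :
    ∃ (X : Type) (_ : NormedAddCommGroup X) (_ : NormedSpace ℝ X) (_ : CompleteSpace X)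
      (e : X ≃L[ℝ] E), ∀ x, ‖x‖ = ‖e x‖ + ‖R (e x)‖ := by
  set J : E →L[ℝ] WithLp 1 (E × H) :=
    (WithLp.prodContinuousLinearEquiv 1 ℝ E H).symm.toContinuousLinearMap.comp
      ((ContinuousLinearMap.id ℝ E).prod R) with hJ
  have hnorm : ∀ x, ‖J x‖ = ‖x‖ + ‖R x‖ := fun x => by
    rw [WithLp.prod_norm_eq_of_nat 1 (by simp)]; simp [hJ]
  have hanti : AntilipschitzWith 1 J := J.antilipschitz_of_bound fun x => by
    rw [hnorm]; simp
  have hclosed : IsClosed (Set.range J) := hanti.isClosed_range J.uniformContinuous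
  have : CompleteSpace J.range := hclosed.completeSpace_coe
  refine ⟨J.range, inferInstance, inferInstance, inferInstance,
    (J.equivRange hanti.injective hclosed).symm, fun x => ?_⟩
  obtain ⟨y, rfl⟩ := (J.equivRange hanti.injective hclosed).surjective x
  rw [ContinuousLinearEquiv.symm_apply_apply]
  exact hnorm y


/-- There exists a real Banach space `X`, linearly homeomorphic to `c₀`, in which no closed
subspace `M` with `dim (X / M) = 2` is proximinal: there is an `x ∈ X` having no nearest
point in `M`. -/
theorem statement10 :
    ∃ (X : Type) (_ : NormedAddCommGroup X) (_ : NormedSpace ℝ X) (_ : CompleteSpace X),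
      Nonempty (X ≃L[ℝ] ZeroAtInftyContinuousMap ℕ ℝ) ∧
      ∀ M : Submodule ℝ X, IsClosed (M : Set X) → Module.finrank ℝ (X ⧸ M) = 2 →
        ∃ x : X, ∀ m ∈ M, ‖x - m‖ ≠ Metric.infDist x (M : Set X) := by
  obtain ⟨R, hR, hRadj⟩ := exists_injective_operator
  obtain ⟨X, _, _, hX, e, he⟩ := exists_equiv_norm_eq R
  exact ⟨X, _, _, hX, ⟨e⟩, fun M hM hdim => not_proximinal_of_norm_eq R hR hRadj e he M hM hdim⟩
end

section
/- Let Φ : ℕ → ℝ satisfy Φ(n) > 0 for all n, Φ summable, and ∑_n Φ(n) < 1, and let S_Φ : ℓ₂ → ℓ₁ be the diagonal operator (S_Φ a)(n) = Φ(n)·a(n). Let ν be a norm on ℓ₁ whose closed unit ball equals {y + S_Φ(a) : ‖y‖₁ ≤ 1, ‖a‖₂ ≤ 1}, and for f ∈ ℓ∞ write ν*(f) = sup{ ∑_n f(n)·x(n) : x ∈ ℓ₁, ν(x) ≤ 1 }. Then for every f ∈ ℓ∞ one has ν*(f) ≥ ‖f‖_∞ ≥ (1 − ∑_n Φ(n))·ν*(f).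 -/
open scoped ENNReal

theorem lp.hasSum_norm_one (y : lp (fun _ : ℕ => ℝ) 1) : HasSum (fun n => |y n|) ‖y‖ := by
  simpa using lp.hasSum_norm (p := 1) (by simp) y

/-- The pairing of `f ∈ ℓ∞` with a point of `B_{ℓ₁} + S_Φ(B_{ℓ₂})` is at most `‖f‖ (1 + ∑ Φ)`. -/
theorem pairing_le_norm_mul_one_add_tsum {Φ : ℕ → ℝ} (hΦ : ∀ n, 0 ≤ Φ n) (hΦsum : Summable Φ)
    (f : lp (fun _ : ℕ => ℝ) ∞) {x y : lp (fun _ : ℕ => ℝ) 1} {a : lp (fun _ : ℕ => ℝ) 2}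
    (hy : ‖y‖ ≤ 1) (ha : ‖a‖ ≤ 1) (hx : ∀ n, x n = y n + Φ n * a n) :
    ∑' n, f n * x n ≤ ‖f‖ * (1 + ∑' n, Φ n) := by
  have hbound : ∀ n, ‖f n * x n‖ ≤ ‖f‖ * (|y n| + Φ n) := by
    intro n
    have hf : ‖f n‖ ≤ ‖f‖ := lp.norm_apply_le_norm (by simp) f n
    have han : |a n| ≤ 1 := (lp.norm_apply_le_norm (by simp) a n).trans ha
    have hxn : ‖x n‖ ≤ |y n| + Φ n := by
      rw [hx, Real.norm_eq_abs]
      refine (abs_add_le _ _).trans ?_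
      rw [abs_mul, abs_of_nonneg (hΦ n)]
      gcongr
      exact mul_le_of_le_one_right (hΦ n) han
    rw [norm_mul]
    gcongr
  have hsum := ((lp.hasSum_norm_one y).add hΦsum.hasSum).mul_left ‖f‖
  calc ∑' n, f n * x n ≤ ‖∑' n, f n * x n‖ := Real.le_norm_self _
    _ ≤ ‖f‖ * (‖y‖ + ∑' n, Φ n) := tsum_of_norm_bounded hsum hbound
    _ ≤ ‖f‖ * (1 + ∑' n, Φ n) := by gcongr

/-- If `ν` is a norm on `ℓ₁` whose closed unit ball is `B_{ℓ₁} + S_Φ(B_{ℓ₂})` for a positive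
summable `Φ` with `∑ Φ < 1`, and `ν*` denotes the associated dual norm on `ℓ∞`, then
`ν*(f) ≥ ‖f‖_∞ ≥ (1 − ∑ Φ)·ν*(f)` for every `f ∈ ℓ∞`. -/
theorem statement13 (Φ : ℕ → ℝ) (hΦpos : ∀ n, 0 < Φ n) (hΦsum : Summable Φ)
    (hΦlt : ∑' n, Φ n < 1)
    (ν : lp (fun _ : ℕ => ℝ) 1 → ℝ)
    (hν_add : ∀ x y : lp (fun _ : ℕ => ℝ) 1, ν (x + y) ≤ ν x + ν y)
    (hν_smul : ∀ (c : ℝ) (x : lp (fun _ : ℕ => ℝ) 1), ν (c • x) = |c| * ν x)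
    (hν_def : ∀ x : lp (fun _ : ℕ => ℝ) 1, ν x = 0 → x = 0)
    (hν_ball : {x : lp (fun _ : ℕ => ℝ) 1 | ν x ≤ 1} =
      {x : lp (fun _ : ℕ => ℝ) 1 |
        ∃ (y : lp (fun _ : ℕ => ℝ) 1) (a : lp (fun _ : ℕ => ℝ) 2),
          ‖y‖ ≤ 1 ∧ ‖a‖ ≤ 1 ∧ ∀ n : ℕ, x n = y n + Φ n * a n}) :
    ∀ f : lp (fun _ : ℕ => ℝ) ∞,
      sSup {s : ℝ | ∃ x : lp (fun _ : ℕ => ℝ) 1, ν x ≤ 1 ∧ s = ∑' n, f n * x n} ≥ ‖f‖ ∧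
      ‖f‖ ≥ (1 - ∑' n, Φ n) *
        sSup {s : ℝ | ∃ x : lp (fun _ : ℕ => ℝ) 1, ν x ≤ 1 ∧ s = ∑' n, f n * x n} := by
  intro f
  set A := {s : ℝ | ∃ x : lp (fun _ : ℕ => ℝ) 1, ν x ≤ 1 ∧ s = ∑' n, f n * x n}
  have hball : ∀ x, ν x ≤ 1 ↔ ∃ (y : lp (fun _ : ℕ => ℝ) 1) (a : lp (fun _ : ℕ => ℝ) 2),
      ‖y‖ ≤ 1 ∧ ‖a‖ ≤ 1 ∧ ∀ n : ℕ, x n = y n + Φ n * a n := Set.ext_iff.mp hν_ball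
  have hupper : ∀ s ∈ A, s ≤ ‖f‖ * (1 + ∑' n, Φ n) := by
    rintro s ⟨x, hx, rfl⟩
    obtain ⟨y, a, hy, ha, hxy⟩ := (hball x).1 hx
    exact pairing_le_norm_mul_one_add_tsum (fun n => (hΦpos n).le) hΦsum f hy ha hxy
  have hsingle : ∀ (n : ℕ) (c : ℝ), |c| ≤ 1 → f n * c ∈ A := by
    intro n c hc
    refine ⟨lp.single 1 n c, (hball _).2 ⟨lp.single 1 n c, 0, ?_, by simp, by simp⟩, ?_⟩
    · rw [lp.norm_single (by simp)]
      exact hc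
    · rw [tsum_eq_single n fun m hm => by simp [lp.single_apply, Pi.single_eq_of_ne hm]]
      simp
  have hbdd : BddAbove A := ⟨_, hupper⟩
  have hle : ∀ n, ‖f n‖ ≤ sSup A := by
    intro n
    refine abs_le'.2 ⟨?_, ?_⟩
    · simpa using le_csSup hbdd (hsingle n 1 (by simp))
    · simpa using le_csSup hbdd (hsingle n (-1) (by simp))
  refine ⟨lp.norm_le_of_forall_le ((norm_nonneg _).trans (hle 0)) hle, ?_⟩
  calc (1 - ∑' n, Φ n) * sSup A ≤ (1 - ∑' n, Φ n) * (‖f‖ * (1 + ∑' n, Φ n)) :=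
        mul_le_mul_of_nonneg_left (csSup_le ⟨_, hsingle 0 0 (by simp)⟩ hupper)
          (sub_nonneg.2 hΦlt.le)
    _ ≤ ‖f‖ := by nlinarith [mul_nonneg (norm_nonneg f) (sq_nonneg (∑' n, Φ n))]
end
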